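/- arXiv:math/0309230 — 2 statements merged into one kernel-verified Lean document; each statement's English description precedes it below -/
import Mathlib

section
/- Let n ≥ 1, let g ∈ GL(n, ℂ), and let s ∈ M_n(ℂ) be skew-Hermitian such that g s g⁻¹ is again skew-Hermitian. Write g = k·h where k is unitary and h is a positive-definite Hermitian matrix (polar decomposition). Then h s h⁻¹ = s, i.e. h commutes with s. -/
open Matrix
open scoped ComplexOrder

open scoped MatrixOrder Matrix.Norms.L2Operator in
/-- A matrix commuting with the square of a positive-definite matrix commutes with the matrix. -/
theorem polar_commute_of_sq {n : ℕ} {h s : Matrix (Fin n) (Fin n) ℂ} (hh : h.PosDef)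
    (h3 : h * h * s = s * (h * h)) : h * s = s * h := by
  have h0 : 0 ≤ h := Matrix.nonneg_iff_posSemidef.mpr hh.posSemidef
  have hc : Commute (h * h) s := h3
  have hc2 : Commute (CFC.sqrt (h * h)) s := hc.cfcₙ_nnreal _
  rw [CFC.sqrt_mul_self h h0] at hc2
  exact hc2

/-- **Matrix form of Lemma 1.10.** If `g ∈ GL(n, ℂ)` conjugates a skew-Hermitian matrix `s`
to a skew-Hermitian matrix, and `g = k * h` is the polar decomposition of `g` (with `k`
unitary and `h` positive-definite Hermitian), then `h` commutes with `s`,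
i.e. `h * s * h⁻¹ = s`. -/
theorem matrix_polar_part_commutes_of_conj_skewHermitian
    (n : ℕ) (hn : 1 ≤ n) (g k h s : Matrix (Fin n) (Fin n) ℂ)
    (hg : IsUnit g)
    (hs : sᴴ = -s)
    (hconj : (g * s * g⁻¹)ᴴ = -(g * s * g⁻¹))
    (hk : k ∈ Matrix.unitaryGroup (Fin n) ℂ)
    (hh : h.PosDef)
    (hpolar : g = k * h) :
    h * s * h⁻¹ = s ∧ h * s = s * h := by
  have hdet : IsUnit g.det := (Matrix.isUnit_iff_isUnit_det g).mp hg
  have hkk : kᴴ * k = 1 := Matrix.mem_unitaryGroup_iff'.mp hk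
  have hH : hᴴ = h := hh.isHermitian
  have hgg : gᴴ * g = h * h := by
    rw [hpolar, Matrix.conjTranspose_mul, hH, Matrix.mul_assoc, ← Matrix.mul_assoc kᴴ, hkk,
      Matrix.one_mul]
  have h1 : gᴴ * (g * s * g⁻¹) * g = h * h * s := by
    rw [← hgg, Matrix.mul_assoc, Matrix.nonsing_inv_mul_cancel_right _ _ hdet, Matrix.mul_assoc]
  have h2 : (h * h * s)ᴴ = -(h * h * s) := by
    rw [← h1, Matrix.conjTranspose_mul, Matrix.conjTranspose_mul, hconj,
      Matrix.conjTranspose_conjTranspose]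
    simp only [Matrix.mul_neg, Matrix.neg_mul, Matrix.mul_assoc]
  have h3 : h * h * s = s * (h * h) := by
    rw [Matrix.conjTranspose_mul, Matrix.conjTranspose_mul, hH, hs, Matrix.neg_mul] at h2
    exact (neg_injective h2).symm
  have h4 : h * s = s * h := polar_commute_of_sq hh h3
  have hhdet : IsUnit h.det := (Matrix.isUnit_iff_isUnit_det h).mp hh.isUnit
  exact ⟨by rw [h4, Matrix.mul_nonsing_inv_cancel_right _ _ hhdet], h4⟩
end

section
/- Let V be a finite-dimensional real normed vector space and let f : V → ℝ be continuous with f(0) = 0 such that for every s ∈ V the function t ↦ f(t·s) is convex on [0,∞). For s ∈ V define λ(s) := sup_{t>0} f(t·s)/t ∈ ℝ ∪ {+∞}. Then the following are equivalent: (1) f is linearly proper on V, i.e. there exist constants c₁ > 0 and c₂ ≥ 0 such that ‖s‖ ≤ c₁ f(s) + c₂ for all s ∈ V; (2) λ(s) > 0 for every s ∈ V \ {0}. -/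
open Set

/-- **Abstract form of Lemma 1.9.** Let `f : V → ℝ` be continuous with `f 0 = 0` on a
finite-dimensional real normed vector space, convex along each ray from the origin.
Define the maximal weight `λ(s) = ⨆_{t > 0} f(t • s) / t ∈ ℝ ∪ {+∞}`.
Then `f` is linearly proper (`‖s‖ ≤ c₁ * f s + c₂`) if and only if `λ(s) > 0` for every
`s ≠ 0`. -/
theorem linearly_proper_iff_maximal_weights_pos
    (V : Type*) [NormedAddCommGroup V] [NormedSpace ℝ V] [FiniteDimensional ℝ V]
    (f : V → ℝ) (hf : Continuous f) (hf0 : f 0 = 0)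
    (hconv : ∀ s : V, ConvexOn ℝ (Set.Ici (0 : ℝ)) fun t : ℝ => f (t • s)) :
    (∃ c₁ : ℝ, 0 < c₁ ∧ ∃ c₂ : ℝ, 0 ≤ c₂ ∧ ∀ s : V, ‖s‖ ≤ c₁ * f s + c₂) ↔
      (∀ s : V, s ≠ 0 →
        (0 : EReal) < ⨆ t ∈ Set.Ioi (0 : ℝ), ((f (t • s) / t : ℝ) : EReal)) := by
  have hmono : ∀ (s : V) (t T : ℝ), 0 ≤ t → t ≤ T → 0 < T → T * f (t • s) ≤ t * f (T • s) := by
    intro s t T ht htT hT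
    have h0 : 0 ≤ 1 - t / T := by
      rw [sub_nonneg, div_le_one hT]
      exact htT
    have h1 : 0 ≤ t / T := by positivity
    have h := (hconv s).2 (Set.mem_Ici.2 (le_refl (0 : ℝ))) (Set.mem_Ici.2 hT.le) h0 h1 (by ring)
    simp only [smul_eq_mul, mul_zero, zero_add, zero_smul, hf0] at h
    rw [div_mul_cancel₀ _ hT.ne'] at h
    calc T * f (t • s) ≤ T * (t / T * f (T • s)) := by gcongr
      _ = t * f (T • s) := by field_simp
  constructor
  · rintro ⟨c₁, hc₁, c₂, hc₂, h⟩ s hs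
    have hn : 0 < ‖s‖ := norm_pos_iff.2 hs
    have ht : 0 < (c₂ + 1) / ‖s‖ := by positivity
    have h1 := h (((c₂ + 1) / ‖s‖) • s)
    rw [norm_smul, Real.norm_of_nonneg ht.le, div_mul_cancel₀ _ hn.ne'] at h1
    have h2 : 0 < f (((c₂ + 1) / ‖s‖) • s) := by
      by_contra! hc
      nlinarith
    have h3 : (0 : EReal) < ((f (((c₂ + 1) / ‖s‖) • s) / ((c₂ + 1) / ‖s‖) : ℝ) : EReal) := by
      exact_mod_cast div_pos h2 ht
    exact h3.trans_le (le_iSup₂_of_le ((c₂ + 1) / ‖s‖) ht le_rfl)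
  · intro h
    have hpos : ∀ s : V, s ≠ 0 → ∃ t : ℝ, 0 < t ∧ 0 < f (t • s) := by
      intro s hs
      have h1 := h s hs
      simp only [lt_iSup_iff] at h1
      obtain ⟨t, ht, h2⟩ := h1
      have ht' : 0 < t := ht
      have h3 : 0 < f (t • s) / t := by exact_mod_cast h2
      exact ⟨t, ht', by simpa [ht'] using (div_pos_iff_of_pos_right ht').1 h3⟩
    have hposmono : ∀ (s : V) (t T : ℝ), 0 < t → t ≤ T → 0 < f (t • s) → 0 < f (T • s) := by
      intro s t T ht htT hp
      have hT := ht.trans_le htT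
      have h1 := hmono s t T ht.le htT hT
      have h2 : 0 < t * f (T • s) := (mul_pos hT hp).trans_le h1
      exact (mul_pos_iff_of_pos_left ht).1 h2
    have hcompact : IsCompact (Metric.sphere (0 : V) 1) := isCompact_sphere 0 1
    obtain ⟨n, hn⟩ := hcompact.elim_directed_cover
      (fun n : ℕ => {u : V | 0 < f (((n : ℝ) + 1) • u)})
      (fun n => isOpen_lt continuous_const (hf.comp (continuous_const_smul _)))
      (by
        intro u hu
        have hu0 : u ≠ 0 := by
          rintro rfl
          simp at hu
        obtain ⟨t, ht, htp⟩ := hpos u hu0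
        obtain ⟨n, hn⟩ := exists_nat_ge t
        exact Set.mem_iUnion.2 ⟨n, hposmono u t _ ht (by linarith) htp⟩)
      (by
        refine directed_of_isDirected_le ?_
        intro a b hab u hu
        refine hposmono u _ _ (by positivity) ?_ hu
        have : (a : ℝ) ≤ b := by exact_mod_cast hab
        linarith)
    obtain ⟨R, hR, hRp⟩ : ∃ R : ℝ, 0 < R ∧ ∀ u ∈ Metric.sphere (0 : V) 1, 0 < f (R • u) :=
      ⟨n + 1, by positivity, fun u hu => hn hu⟩
    obtain ⟨δ, hδ, hδle⟩ := hcompact.exists_forall_le'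
      (f := fun u => f (R • u)) (hf.comp (continuous_const_smul R)).continuousOn hRp
    obtain ⟨M, hM⟩ := (isCompact_closedBall (0 : V) R).bddBelow_image hf.continuousOn
    have hM' : ∀ s : V, ‖s‖ ≤ R → -|M| ≤ f s := fun s hs =>
      (neg_abs_le M).trans (hM (Set.mem_image_of_mem f (by simpa using hs)))
    refine ⟨R / δ, by positivity, R + R / δ * |M|, by positivity, fun s => ?_⟩
    have hRδ : 0 < R / δ := by positivity
    rcases le_total ‖s‖ R with hs | hs
    · have h1 := mul_le_mul_of_nonneg_left (hM' s hs) hRδ.le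
      linarith
    · have hs0 : 0 < ‖s‖ := hR.trans_le hs
      have h1 := hmono (‖s‖⁻¹ • s) R ‖s‖ hR.le hs hs0
      rw [smul_inv_smul₀ hs0.ne'] at h1
      have h2 : δ ≤ f (R • (‖s‖⁻¹ • s)) :=
        hδle _ (by simp [norm_smul, hs0.ne'])
      have h3 : ‖s‖ * δ ≤ R * f s := (mul_le_mul_of_nonneg_left h2 hs0.le).trans h1
      have h4 : ‖s‖ ≤ R / δ * f s := by
        rw [div_mul_eq_mul_div, le_div_iff₀ hδ]
        exact h3
      have h5 : 0 ≤ R / δ * |M| := by positivity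
      linarith
end
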